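/- arXiv:1407.3516 — 3 statements merged into one kernel-verified Lean document; each statement's English description precedes it below -/
import Mathlib

section
/- If n > m ≥ 1 and k ≥ 1, then a(n,m,k) = Σ_{d=1}^{ℓ} Σ_{j=1}^{n−m} binomial(m−1,d)·binomial(j,d)·a(n−m, j, k−d), where ℓ = min{m,k}. Moreover a(n,n,k) = δ_{k,0} for n > k ≥ 0, and a(n,m,0) = δ_{n,m} for n ≥ m ≥ 1. -/
/-- A Catalan word: a word `a : Fin n → ℕ` satisfying (i) `a (i+1) ≥ a i - 1` for all
adjacent positions, and (ii) if `i` is the minimal index with `a i = k > 0`, then there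
exist `i₁ < i < i₂` with `a i₁ = a i₂ = k - 1`. -/
def IsCatalanWord {n : ℕ} (a : Fin n → ℕ) : Prop :=
  (∀ (i : ℕ) (h : i + 1 < n), a ⟨i, Nat.lt_of_succ_lt h⟩ ≤ a ⟨i + 1, h⟩ + 1) ∧
  (∀ i : Fin n, 0 < a i → (∀ j : Fin n, a j = a i → i ≤ j) →
    ((∃ i₁ : Fin n, i₁ < i ∧ a i₁ + 1 = a i) ∧ (∃ i₂ : Fin n, i < i₂ ∧ a i₂ + 1 = a i)))

/-- The number of letters of the word `a` equal to `c`. -/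
noncomputable def countEq {n : ℕ} (a : Fin n → ℕ) (c : ℕ) : ℕ :=
  Set.ncard {i : Fin n | a i = c}

/-- The number of descents of the word `a`. -/
noncomputable def numDesc {n : ℕ} (a : Fin n → ℕ) : ℕ :=
  Set.ncard {i : ℕ | ∃ h : i + 1 < n, a ⟨i + 1, h⟩ < a ⟨i, Nat.lt_of_succ_lt h⟩}

/-- `aZD n m k` is the number of Catalan words of length `n` with `m` zeros and
`k` descents. -/
noncomputable def aZD (n m k : ℕ) : ℕ :=
  Set.ncard {a : Fin n → ℕ | IsCatalanWord a ∧ countEq a 0 = m ∧ numDesc a = k}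

namespace CatalanWord

/-- The number of descents of a list of natural numbers. -/
def descents : List ℕ → ℕ
  | [] => 0
  | [_] => 0
  | x :: y :: w => (if y < x then 1 else 0) + descents (y :: w)

/-- The number of positions at which a nonzero letter is followed by a zero. -/
def drops : List ℕ → ℕ
  | [] => 0
  | [_] => 0
  | x :: y :: w => (if x ≠ 0 ∧ y = 0 then 1 else 0) + drops (y :: w)

/-- Every letter drops by at most one at each step. -/
abbrev IsSlow (w : List ℕ) : Prop := w.IsChain fun x y => x ≤ y + 1

/-- Every letter followed by a zero is at most one. -/
abbrev IsSlowAtZero (w : List ℕ) : Prop := w.IsChain fun x y => y = 0 → x ≤ 1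

/-- The first occurrence of each positive letter lies strictly between two occurrences of its
predecessor. -/
def IsNested (w : List ℕ) : Prop :=
  ∀ u v k, w = u ++ (k + 1) :: v → k + 1 ∉ u → k ∈ u ∧ k ∈ v

/-- The nonzero letters of a word. -/
def nonzeros (w : List ℕ) : List ℕ := w.filter (· ≠ 0)

@[simp] lemma nonzeros_nil : nonzeros [] = [] := rfl

@[simp] lemma nonzeros_zero_cons (w : List ℕ) : nonzeros (0 :: w) = nonzeros w := by
  simp [nonzeros]

@[simp] lemma nonzeros_succ_cons (x : ℕ) (w : List ℕ) :
    nonzeros ((x + 1) :: w) = (x + 1) :: nonzeros w := by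
  simp [nonzeros]

lemma mem_nonzeros {x : ℕ} {w : List ℕ} : x ∈ nonzeros w ↔ x ∈ w ∧ x ≠ 0 := by
  simp [nonzeros]

lemma head?_nonzeros_pos {w : List ℕ} {y : ℕ} (h : y ∈ (nonzeros w).head?) : 1 ≤ y :=
  Nat.one_le_iff_ne_zero.2 (mem_nonzeros.1 (List.mem_of_mem_head? h)).2

lemma isSlow_iff_nonzeros (w : List ℕ) :
    IsSlow w ↔ IsSlow (nonzeros w) ∧ IsSlowAtZero w := by
  induction w with
  | nil => simp
  | cons x w ih =>
    cases x with
    | zero => simp [IsSlow, IsSlowAtZero, List.isChain_cons] at ih ⊢; tauto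
    | succ x =>
      have hpos := @head?_nonzeros_pos w
      cases w with
      | nil => simp
      | cons y w =>
        cases y with
        | zero =>
          simp only [IsSlow, IsSlowAtZero, nonzeros_succ_cons, List.isChain_cons (x := x + 1)]
            at ih ⊢
          simp only [ih]
          constructor
          · rintro ⟨hx, h₁, h₂⟩
            have hx' : x = 0 := by simpa using hx
            refine ⟨⟨fun y hy => ?_, h₁⟩, by simpa using hx', h₂⟩
            have := hpos hy
            omega
          · rintro ⟨⟨-, h₁⟩, hx, h₂⟩
            have hx' : x = 0 := by simpa using hx
            exact ⟨by simp [hx'], h₁, h₂⟩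
        | succ y =>
          simp [IsSlow, IsSlowAtZero] at ih ⊢
          tauto

lemma descents_zero_cons (w : List ℕ) : descents (0 :: w) = descents w := by
  cases w <;> simp [descents]

lemma drops_zero_cons (w : List ℕ) : drops (0 :: w) = drops w := by
  cases w <;> simp [drops]

lemma descents_cons_of_forall_head? {x : ℕ} {w : List ℕ} (h : ∀ y ∈ w.head?, x ≤ y) :
    descents (x :: w) = descents w := by
  cases w with
  | nil => rfl
  | cons y w => simp_all [descents]

lemma descents_eq_add_drops {w : List ℕ} (h : IsSlowAtZero w) :
    descents w = descents (nonzeros w) + drops w := by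
  induction w with
  | nil => rfl
  | cons x w ih =>
    specialize ih (List.isChain_cons.1 h).2
    cases x with
    | zero => simpa [descents_zero_cons, drops_zero_cons] using ih
    | succ x =>
      have hpos := @head?_nonzeros_pos w
      cases w with
      | nil => simp [descents, drops]
      | cons y w =>
        cases y with
        | zero =>
          have hx : x = 0 := by simpa using (List.isChain_cons.1 h).1 0 (by simp)
          have hd : descents ((x + 1) :: nonzeros (0 :: w)) = descents (nonzeros (0 :: w)) :=
            descents_cons_of_forall_head? fun y hy => by
              have := hpos hy
              omega
          rw [nonzeros_succ_cons, hd]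
          simp only [descents, drops, ih]
          simp
          omega
        | succ y =>
          simp [descents, drops] at ih ⊢
          omega

lemma descents_map_succ (b : List ℕ) : descents (b.map Nat.succ) = descents b := by
  induction b with
  | nil => rfl
  | cons x b ih => cases b <;> simp_all [descents]

lemma isSlow_map_succ (b : List ℕ) : IsSlow (b.map Nat.succ) ↔ IsSlow b := by
  simp [IsSlow, List.isChain_map]

lemma drops_le_count_zero (w : List ℕ) : drops w ≤ w.tail.count 0 := by
  induction w with
  | nil => simp [drops]
  | cons x w ih =>
    cases w with
    | nil => simp [drops]
    | cons y w => simp [drops, List.count_cons] at ih ⊢; grind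

lemma drops_le_drops_append (u w : List ℕ) : drops w ≤ drops (u ++ w) := by
  induction u with
  | nil => simp
  | cons x u ih =>
    refine ih.trans ?_
    cases h : u ++ w <;> simp [h, drops]

lemma drops_pos_of_zero_mem {x : ℕ} {w : List ℕ} (h : 0 ∈ w) : 0 < drops ((x + 1) :: w) := by
  induction w generalizing x with
  | nil => simp at h
  | cons y w ih =>
    cases y with
    | zero => simp [drops]
    | succ y =>
      have := ih (x := y) (by simpa using h)
      simp [drops, this]

lemma zero_mem_of_drops_pos {w : List ℕ} (hs : IsSlowAtZero w) (h : 0 < drops w) {u v : List ℕ}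
    (hw : w = u ++ 1 :: v) (hu : 1 ∉ u) : 0 ∈ v := by
  induction w generalizing u with
  | nil => simp at hw
  | cons x w ih =>
    cases u with
    | nil =>
      have := drops_le_count_zero (x :: w)
      obtain ⟨rfl, rfl⟩ : x = 1 ∧ w = v := by simpa using hw
      exact List.count_pos_iff.1 (h.trans_le this)
    | cons y u =>
      obtain ⟨rfl, rfl⟩ : x = y ∧ w = u ++ 1 :: v := by simpa using hw
      refine ih (List.isChain_cons.1 hs).2 ?_ rfl fun h1 => hu (by simp [h1])
      cases h' : u ++ 1 :: v with
      | nil => simp at h'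
      | cons z w =>
        rw [h'] at hs h
        have hz := (List.isChain_cons.1 hs).1 z (by simp)
        have hx1 : x ≠ 1 := fun hx => hu (by simp [hx])
        simp only [drops] at h
        split_ifs at h with hc <;> omega

lemma IsNested.head_eq_zero {w : List ℕ} (h : IsNested w) (hw : w ≠ []) : ∃ v, w = 0 :: v := by
  cases w with
  | nil => exact absurd rfl hw
  | cons x w =>
    cases x with
    | zero => exact ⟨w, rfl⟩
    | succ x => simpa using (h [] w x rfl (by simp)).1

lemma IsNested.drops_pos {w : List ℕ} (h : IsNested w) (hw : 1 ∈ w) : 0 < drops w := by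
  obtain ⟨u, v, rfl, hu⟩ := List.eq_append_cons_of_mem hw
  exact (drops_pos_of_zero_mem (h u v 0 rfl hu).2).trans_le (drops_le_drops_append _ _)

lemma IsNested.mem_of_le {w : List ℕ} (h : IsNested w) {k j : ℕ} (hk : k ∈ w) (hj : j ≤ k) :
    j ∈ w := by
  induction k with
  | zero => simp_all
  | succ k ih =>
    obtain rfl | hj := hj.eq_or_lt
    · exact hk
    obtain ⟨u, v, rfl, hu⟩ := List.eq_append_cons_of_mem hk
    exact ih (by simp [(h u v k rfl hu).1]) (by omega)

lemma IsNested.lt_length {w : List ℕ} (h : IsNested w) {k : ℕ} (hk : k ∈ w) : k < w.length := by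
  have : Finset.range (k + 1) ⊆ w.toFinset := fun j hj => by
    simp only [List.mem_toFinset]
    exact h.mem_of_le hk (by simpa [Nat.lt_succ_iff] using hj)
  have := Finset.card_le_card this
  have := w.toFinset_card_le
  simp at *
  omega

/-- Nestedness of a word can be read off its nonzero letters once it starts with a zero. -/
lemma isNested_zero_cons_iff {b w : List ℕ} (hb : nonzeros w = b.map Nat.succ) (hb0 : b ≠ [])
    (hs : IsSlowAtZero (0 :: w)) :
    IsNested (0 :: w) ↔ IsNested b ∧ 0 < drops (0 :: w) := by
  constructor
  · intro h
    have hnest : IsNested b := by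
      rintro u v k rfl hu
      simp only [nonzeros, List.map_append, List.map_cons, List.filter_eq_append_iff] at hb
      obtain ⟨w₁, w₂, rfl, h₁, h₂⟩ := hb
      obtain ⟨w₃, w₄, rfl, h₃, -, h₄⟩ := List.filter_eq_cons_iff.1 h₂
      have key := h (0 :: w₁ ++ w₃) w₄ (k + 1) (by simp) (by
        have h5 : k + 1 + 1 ∉ w₁ := fun hm => hu (by
          have : k + 1 + 1 ∈ List.filter (· ≠ 0) w₁ := by simp [hm]
          rw [h₁] at this
          simpa using this)
        have h6 : k + 1 + 1 ∉ w₃ := fun hm => by simpa using h₃ _ hm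
        simp [h5, h6])
      constructor
      · have hm : k + 1 ∈ List.filter (· ≠ 0) w₁ := by
          have h6 : k + 1 ∉ w₃ := fun hm => by simpa using h₃ _ hm
          simpa [h6] using key.1
        rw [h₁] at hm
        simpa using hm
      · have hm : k + 1 ∈ List.filter (· ≠ 0) w₄ := by simpa using key.2
        rw [h₄] at hm
        simpa using hm
    refine ⟨hnest, h.drops_pos ?_⟩
    obtain ⟨v, rfl⟩ := hnest.head_eq_zero hb0
    have : 1 ∈ nonzeros w := by simp [hb]
    simp [(mem_nonzeros.1 this).1]
  · rintro ⟨h, hd⟩ u v k hw hu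
    obtain ⟨u, rfl⟩ : ∃ u', u = 0 :: u' := by
      cases u with
      | nil => simp at hw
      | cons x u => exact ⟨u, by simp_all⟩
    cases k with
    | zero => exact ⟨by simp, zero_mem_of_drops_pos hs hd hw hu⟩
    | succ k =>
      obtain rfl : w = u ++ (k + 1 + 1) :: v := by simpa using hw
      have hb' : nonzeros u ++ (k + 1 + 1) :: nonzeros v = b.map Nat.succ := by
        rw [← hb]; simp [nonzeros]
      obtain ⟨b₁, b₂, rfl, h₁, h₂⟩ := List.map_eq_append_iff.1 hb'.symm
      obtain ⟨x, b₃, rfl, hx, h₃⟩ := List.map_eq_cons_iff.1 h₂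
      obtain rfl : x = k + 1 := by simpa using hx
      have key := h b₁ b₃ k rfl (fun hm => hu (by
        have : k + 1 + 1 ∈ nonzeros u := by rw [← h₁]; simpa using hm
        simp [(mem_nonzeros.1 this).1]))
      constructor
      · have : k + 1 ∈ nonzeros u := by rw [← h₁]; simpa using key.1
        simp [(mem_nonzeros.1 this).1]
      · have : k + 1 ∈ nonzeros v := by rw [← h₃]; simpa using key.2
        simp [(mem_nonzeros.1 this).1]

/-- The words with `m` zeros and `d` drops which have `b` as their subword of nonzero letters. -/
def weaves (b : List ℕ) (m d : ℕ) : Set (List ℕ) :=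
  {w | nonzeros w = b ∧ w.count 0 = m ∧ IsSlowAtZero w ∧ drops w = d}

/-- The members of `weaves b m d` which do not start with a zero. -/
def properWeaves (b : List ℕ) (m d : ℕ) : Set (List ℕ) :=
  {w ∈ weaves b m d | w.head? ≠ some 0}

/-- The number of compositions of `m` into `d` positive parts. -/
def numCompositions : ℕ → ℕ → ℕ
  | 0, 0 => 1
  | m + 1, d + 1 => m.choose d
  | _, _ => 0

lemma zero_cons_mem_weaves {b w : List ℕ} {m d : ℕ} :
    0 :: w ∈ weaves b m d ↔ w.count 0 + 1 = m ∧ w ∈ weaves b (w.count 0) d := by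
  simp only [weaves, Set.mem_ofPred_eq, nonzeros_zero_cons, List.count_cons_self,
    drops_zero_cons, IsSlowAtZero, List.isChain_cons (x := 0)]
  simp
  tauto

lemma weaves_zero (b : List ℕ) (d : ℕ) : weaves b 0 d = properWeaves b 0 d := by
  ext w
  cases w with
  | nil => simp [properWeaves]
  | cons x w => cases x <;> simp [properWeaves, zero_cons_mem_weaves]

lemma weaves_succ (b : List ℕ) (m d : ℕ) :
    weaves b (m + 1) d = (0 :: ·) '' weaves b m d ∪ properWeaves b (m + 1) d := by
  ext w
  cases w with
  | nil => simp [properWeaves]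
  | cons x w =>
    cases x with
    | zero =>
      simp only [properWeaves, Set.mem_union, Set.mem_image, Set.mem_ofPred_eq,
        zero_cons_mem_weaves]
      simp
      simp only [weaves, Set.mem_ofPred_eq]
      grind
    | succ x => simp [properWeaves]

lemma encard_weaves_of_properWeaves {b : List ℕ} {d z : ℕ}
    (h : ∀ m, (properWeaves b m d).encard = (numCompositions m d * z.choose d : ℕ)) (m : ℕ) :
    (weaves b m d).encard = (m.choose d * z.choose d : ℕ) := by
  induction m with
  | zero => rw [weaves_zero, h]; cases d <;> simp [numCompositions]
  | succ m ih =>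
    rw [weaves_succ, Set.encard_union_eq, List.cons_injective.encard_image, ih, h]
    · norm_cast
      cases d with
      | zero => simp [numCompositions]
      | succ d => simp [numCompositions, Nat.choose_succ_succ]; ring
    · rw [Set.disjoint_left]
      rintro _ ⟨w, -, rfl⟩ ⟨-, h⟩
      simp at h

lemma properWeaves_nil (m d : ℕ) :
    properWeaves [] m d = if m = 0 ∧ d = 0 then {[]} else ∅ := by
  ext w
  cases w with
  | nil => split_ifs <;> simp [properWeaves, weaves, drops] <;> grind
  | cons x w => cases x <;> split_ifs <;> simp [properWeaves, weaves]

lemma properWeaves_succ_succ_cons (x : ℕ) (b : List ℕ) (m d : ℕ) :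
    properWeaves ((x + 2) :: b) m d = ((x + 2) :: ·) '' properWeaves b m d := by
  ext w
  cases w with
  | nil => simp [properWeaves, weaves]
  | cons y w =>
    cases y with
    | zero => simp [properWeaves]
    | succ y =>
      rcases w with _ | ⟨_ | z, w⟩ <;>
        simp [properWeaves, weaves, IsSlowAtZero, drops] <;> grind

lemma properWeaves_one_cons_of_eq_zero (b : List ℕ) {m d : ℕ} (h : m = 0 ∨ d = 0) :
    properWeaves (1 :: b) m d = (1 :: ·) '' properWeaves b m d := by
  ext w
  cases w with
  | nil => simp [properWeaves, weaves]
  | cons y w =>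
    cases y with
    | zero => simp [properWeaves]
    | succ y =>
      rcases w with _ | ⟨_ | z, w⟩ <;>
        simp [properWeaves, weaves, IsSlowAtZero, drops] <;> grind

lemma properWeaves_one_cons (b : List ℕ) (m d : ℕ) :
    properWeaves (1 :: b) (m + 1) (d + 1) =
      (1 :: ·) '' (properWeaves b (m + 1) (d + 1) ∪ (0 :: ·) '' weaves b m d) := by
  ext w
  cases w with
  | nil => simp [properWeaves, weaves]
  | cons y w =>
    cases y with
    | zero => simp [properWeaves]
    | succ y =>
      rcases w with _ | ⟨_ | z, w⟩
      · simp [properWeaves, weaves, drops]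
      · have := drops_zero_cons w
        simp [properWeaves, weaves, IsSlowAtZero, drops, this, List.isChain_cons (x := 0)]
        grind
      · simp [properWeaves, weaves, IsSlowAtZero, drops]
        grind

lemma encard_properWeaves (b : List ℕ) (m d : ℕ) :
    (properWeaves (b.map Nat.succ) m d).encard =
      (numCompositions m d * (b.count 0).choose d : ℕ) := by
  induction b generalizing m d with
  | nil =>
    rw [List.map_nil, properWeaves_nil]
    cases m <;> cases d <;> simp [numCompositions]
  | cons x b ih =>
    cases x with
    | succ x =>
      simp only [List.map_cons, Nat.succ_eq_add_one]
      rw [properWeaves_succ_succ_cons, List.cons_injective.encard_image, ih]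
      simp
    | zero =>
      simp only [List.map_cons, Nat.succ_eq_add_one, zero_add, List.count_cons_self]
      by_cases h : m = 0 ∨ d = 0
      · rw [properWeaves_one_cons_of_eq_zero _ h, List.cons_injective.encard_image, ih]
        rcases h with rfl | rfl
        · cases d <;> simp [numCompositions]
        · simp
      · obtain ⟨m, rfl⟩ := Nat.exists_eq_succ_of_ne_zero (not_or.1 h).1
        obtain ⟨d, rfl⟩ := Nat.exists_eq_succ_of_ne_zero (not_or.1 h).2
        simp only [Nat.succ_eq_add_one]
        rw [properWeaves_one_cons, List.cons_injective.encard_image, Set.encard_union_eq,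
          List.cons_injective.encard_image, ih, encard_weaves_of_properWeaves fun m => ih m d]
        · norm_cast
          simp [numCompositions, Nat.choose_succ_succ]
          ring
        · rw [Set.disjoint_right]
          rintro _ ⟨w, -, rfl⟩ ⟨-, h⟩
          simp at h

lemma ncard_weaves (b : List ℕ) (m d : ℕ) :
    (weaves (b.map Nat.succ) m d).ncard = m.choose d * (b.count 0).choose d := by
  rw [Set.ncard, encard_weaves_of_properWeaves fun m => encard_properWeaves b m d]
  simp

/-- Catalan words of length `n` with `m` zeros and `k` descents, as lists. -/
def words (n m k : ℕ) : Set (List ℕ) :=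
  {w | w.length = n ∧ IsSlow w ∧ IsNested w ∧ w.count 0 = m ∧ descents w = k}

lemma isNested_ofFn {n : ℕ} (a : Fin n → ℕ) :
    IsNested (List.ofFn a) ↔ ∀ i : Fin n, 0 < a i → (∀ j : Fin n, a j = a i → i ≤ j) →
      (∃ i₁ : Fin n, i₁ < i ∧ a i₁ + 1 = a i) ∧ ∃ i₂ : Fin n, i < i₂ ∧ a i₂ + 1 = a i := by
  constructor
  · intro h i hi hmin
    obtain ⟨k, hk⟩ := Nat.exists_eq_succ_of_ne_zero hi.ne'
    have key := h ((List.ofFn a).take i) ((List.ofFn a).drop (i + 1)) k (by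
      rw [← Nat.succ_eq_add_one, ← hk]
      conv_lhs => rw [← List.take_append_drop i (List.ofFn a)]
      rw [List.drop_eq_getElem_cons (by simp)]
      simp) (by
      rw [List.mem_take_iff_getElem]
      rintro ⟨j, hj, h⟩
      have hj' : j < n ∧ j < i := by simp at hj; omega
      have := hmin ⟨j, hj'.1⟩ (by simpa [hk] using h)
      have := Fin.le_def.1 this
      simp at this
      omega)
    constructor
    · obtain ⟨j, hj, hjk⟩ := List.mem_take_iff_getElem.1 key.1
      have hj' : j < n ∧ j < i := by simp at hj; omega
      exact ⟨⟨j, hj'.1⟩, Fin.lt_def.2 hj'.2, by rw [hk, ← hjk]; simp⟩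
    · obtain ⟨j, hj, hjk⟩ := List.mem_drop_iff_getElem.1 key.2
      have hj' : i + 1 + j < n := by simp at hj; omega
      exact ⟨⟨i + 1 + j, hj'⟩, Fin.lt_def.2 (by simp; omega), by rw [hk, ← hjk]; simp⟩
  · intro h u v k hw hu
    have hlen : u.length + (v.length + 1) = n := by
      simpa using (congrArg List.length hw).symm
    have hget (j : Fin n) : a j = (u ++ (k + 1) :: v)[(j : ℕ)]'(by simp; omega) := by
      simp [← hw]
    have hi : a ⟨u.length, by omega⟩ = k + 1 := by simp [hget]
    obtain ⟨⟨i₁, h₁, h₁'⟩, i₂, h₂, h₂'⟩ := h ⟨u.length, by omega⟩ (by omega) (by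
      intro j hj
      by_contra hlt
      have hlt' : (j : ℕ) < u.length := by simpa [Fin.lt_def] using hlt
      rw [hi, hget, List.getElem_append_left hlt'] at hj
      exact hu (hj ▸ List.getElem_mem _))
    rw [Fin.lt_def] at h₁ h₂
    simp only at h₁ h₂
    rw [hi] at h₁' h₂'
    constructor
    · have : a i₁ = k := by omega
      rw [hget, List.getElem_append_left h₁] at this
      exact this ▸ List.getElem_mem _
    · have : a i₂ = k := by omega
      rw [hget, List.getElem_append_right h₂.le,
        List.getElem_cons, dif_neg (by omega)] at this
      exact this ▸ List.getElem_mem _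

lemma isCatalanWord_iff {n : ℕ} (a : Fin n → ℕ) :
    IsCatalanWord a ↔ IsSlow (List.ofFn a) ∧ IsNested (List.ofFn a) := by
  rw [isNested_ofFn, IsSlow, List.isChain_ofFn, IsCatalanWord]

lemma countEq_eq_count_ofFn {n : ℕ} (a : Fin n → ℕ) (c : ℕ) :
    countEq a c = (List.ofFn a).count c := by
  rw [countEq, Set.ncard_eq_toFinset_card']
  induction n with
  | zero => simp
  | succ n ih =>
    have := ih fun i => a i.succ
    simp only [Set.toFinset_ofPred] at this ⊢
    rw [Fin.card_filter_univ_succ, this, List.ofFn_succ, List.count_cons]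
    split_ifs <;> simp_all

lemma numDesc_eq_descents_ofFn {n : ℕ} (a : Fin n → ℕ) :
    numDesc a = descents (List.ofFn a) := by
  induction n with
  | zero => simp [numDesc, descents]
  | succ n ih =>
    cases n with
    | zero => simp [numDesc, descents]
    | succ n =>
      have hset : {i : ℕ | ∃ h : i + 1 < n + 1 + 1, a ⟨i + 1, h⟩ < a ⟨i, Nat.lt_of_succ_lt h⟩} =
          {i | i = 0 ∧ a 1 < a 0} ∪ Nat.succ '' {i : ℕ | ∃ h : i + 1 < n + 1,
            a (Fin.succ ⟨i + 1, h⟩) < a (Fin.succ ⟨i, Nat.lt_of_succ_lt h⟩)} := by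
        ext i
        cases i with
        | zero => simp
        | succ i => simp
      have hfin : {i : ℕ | ∃ h : i + 1 < n + 1,
          a (Fin.succ ⟨i + 1, h⟩) < a (Fin.succ ⟨i, Nat.lt_of_succ_lt h⟩)}.Finite :=
        (Set.finite_lt_nat (n + 1)).subset fun i ⟨h, _⟩ => by simp; omega
      have hfin₀ : {i : ℕ | i = 0 ∧ a 1 < a 0}.Finite :=
        (Set.finite_singleton 0).subset fun i hi => hi.1
      have ih := ih fun i => a i.succ
      rw [numDesc] at ih ⊢
      rw [hset, Set.ncard_union_eq ?_ hfin₀ (hfin.image _), Set.ncard_image_of_injective _ Nat.succ_injective, ih]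
      · simp only [List.ofFn_succ, descents]
        congr 1
        by_cases h : a 1 < a 0 <;> simp [h]
      · rw [Set.disjoint_left]
        rintro _ ⟨rfl, -⟩ ⟨i, -, hi⟩
        simp at hi

lemma image_ofFn_eq_words (n m k : ℕ) :
    List.ofFn '' {a : Fin n → ℕ | IsCatalanWord a ∧ countEq a 0 = m ∧ numDesc a = k} =
      words n m k := by
  ext w
  simp only [Set.mem_image, Set.mem_ofPred_eq, isCatalanWord_iff, countEq_eq_count_ofFn,
    numDesc_eq_descents_ofFn, words]
  constructor
  · rintro ⟨a, ⟨⟨h₁, h₂⟩, h₃, h₄⟩, rfl⟩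
    exact ⟨by simp, h₁, h₂, h₃, h₄⟩
  · rintro ⟨rfl, h₁, h₂, h₃, h₄⟩
    refine ⟨w.get, ?_, List.ofFn_get w⟩
    rw [List.ofFn_get]
    exact ⟨⟨h₁, h₂⟩, h₃, h₄⟩

lemma aZD_eq_ncard_words (n m k : ℕ) : aZD n m k = (words n m k).ncard := by
  rw [← image_ofFn_eq_words, Set.ncard_image_of_injective _ List.ofFn_injective, aZD]

lemma finite_words (n m k : ℕ) : (words n m k).Finite := by
  have : words n m k ⊆ List.ofFn '' Set.Iic fun _ : Fin n => n := by
    rintro w ⟨rfl, -, h, -⟩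
    exact ⟨w.get, fun i => (h.lt_length (List.get_mem w i)).le, List.ofFn_get w⟩
  exact ((Set.finite_Iic _).image _).subset this

lemma length_eq_length_nonzeros_add (w : List ℕ) :
    w.length = (nonzeros w).length + w.count 0 := by
  induction w with
  | nil => rfl
  | cons x w ih => cases x <;> simp [ih] <;> omega

lemma map_succ_map_pred_nonzeros (w : List ℕ) :
    ((nonzeros w).map Nat.pred).map Nat.succ = nonzeros w := by
  induction w with
  | nil => rfl
  | cons x w ih => cases x <;> simp [ih]

/-- A word starting with a zero is a Catalan word exactly when its nonzero letters, decreased by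
one, form a Catalan word and it has a drop. -/
lemma zero_cons_mem_words_iff {n m k : ℕ} {w b : List ℕ} (hmn : m < n)
    (hb : nonzeros w = b.map Nat.succ) :
    0 :: w ∈ words n m k ↔ b ∈ words (n - m) (b.count 0) (k - drops w) ∧
      0 < drops w ∧ drops w ≤ k ∧ w ∈ weaves (b.map Nat.succ) (m - 1) (drops w) ∧ 0 < m := by
  have hlen := length_eq_length_nonzeros_add (0 :: w)
  have hslow := isSlow_iff_nonzeros (0 :: w)
  rw [nonzeros_zero_cons, hb] at hlen hslow
  simp only [List.length_map, isSlow_map_succ] at hlen hslow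
  have hsz : IsSlowAtZero (0 :: w) ↔ IsSlowAtZero w := by
    simp [IsSlowAtZero, List.isChain_cons (x := 0)]
  by_cases hs : IsSlowAtZero w
  · have hdesc := descents_eq_add_drops (hsz.2 hs)
    rw [nonzeros_zero_cons, hb, descents_map_succ, drops_zero_cons] at hdesc
    by_cases hb0 : b = []
    · simp only [words, Set.mem_ofPred_eq, hlen, hb0]
      simp
      omega
    · have hnest := isNested_zero_cons_iff hb hb0 (hsz.2 hs)
      simp only [words, weaves, Set.mem_ofPred_eq, hslow, hnest, hsz, hs, hdesc, hlen, hb,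
        drops_zero_cons]
      simp
      grind
  · simp [words, weaves, hslow, hsz, hs]

lemma exists_eq_zero_cons_of_mem_words {n m k : ℕ} {w : List ℕ} (hn : 0 < n)
    (h : w ∈ words n m k) : ∃ v, w = 0 :: v :=
  h.2.2.1.head_eq_zero fun h' => by
    have := h.1
    simp [h'] at this
    omega

lemma drops_pos_of_mem_words {n m k : ℕ} {w : List ℕ} (hmn : m < n)
    (h : w ∈ words n m k) : 0 < drops w ∧ drops w ≤ k := by
  obtain ⟨v, rfl⟩ := exists_eq_zero_cons_of_mem_words (by omega) h
  have := (zero_cons_mem_words_iff hmn (map_succ_map_pred_nonzeros v).symm).1 h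
  rw [drops_zero_cons]
  exact ⟨this.2.1, this.2.2.1⟩

lemma setOf_mem_words_eq_image {n m k d : ℕ} {b : List ℕ} (hm : 0 < m) (hmn : m < n)
    (hd : 0 < d) (hdk : d ≤ k) (hb : b ∈ words (n - m) (b.count 0) (k - d)) :
    {w ∈ words n m k | drops w = d ∧ (nonzeros w).map Nat.pred = b} =
      (0 :: ·) '' weaves (b.map Nat.succ) (m - 1) d := by
  ext w
  constructor
  · rintro ⟨hw, rfl, rfl⟩
    obtain ⟨v, rfl⟩ := exists_eq_zero_cons_of_mem_words (by omega) hw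
    have := (zero_cons_mem_words_iff hmn (map_succ_map_pred_nonzeros v).symm).1 hw
    exact ⟨v, by simpa [drops_zero_cons] using this.2.2.2.1, rfl⟩
  · rintro ⟨v, hv, rfl⟩
    obtain rfl := hv.2.2.2
    refine ⟨(zero_cons_mem_words_iff hmn hv.1).2 ⟨hb, hd, hdk, hv, hm⟩, drops_zero_cons v, ?_⟩
    rw [nonzeros_zero_cons, hv.1, List.map_map]
    exact List.map_id b

lemma map_pred_nonzeros_mem_words {n m k : ℕ} {w : List ℕ} (hmn : m < n) (hw : w ∈ words n m k) :
    (nonzeros w).map Nat.pred ∈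
      words (n - m) (((nonzeros w).map Nat.pred).count 0) (k - drops w) := by
  obtain ⟨v, rfl⟩ := exists_eq_zero_cons_of_mem_words (by omega) hw
  have := (zero_cons_mem_words_iff hmn (map_succ_map_pred_nonzeros v).symm).1 hw
  simpa [drops_zero_cons] using this.1

lemma ncard_words_eq_sum {n m k : ℕ} (hm : 1 ≤ m) (hmn : m < n) :
    (words n m k).ncard = ∑ d ∈ Finset.Icc 1 (min m k), ∑ j ∈ Finset.Icc 1 (n - m),
      (m - 1).choose d * j.choose d * (words (n - m) j (k - d)).ncard := by
  classical
  have hfin := finite_words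
  rw [Set.ncard_eq_toFinset_card _ (hfin n m k),
    Finset.card_eq_sum_card_fiberwise (f := drops) (t := Finset.Icc 1 (min m k))]
  · refine Finset.sum_congr rfl fun d hd => ?_
    simp only [Finset.mem_Icc, le_min_iff] at hd
    rw [Finset.card_eq_sum_card_fiberwise (f := fun w => ((nonzeros w).map Nat.pred).count 0)
      (t := Finset.Icc 1 (n - m))]
    · refine Finset.sum_congr rfl fun j hj => ?_
      rw [Finset.card_eq_sum_card_fiberwise (f := fun w => (nonzeros w).map Nat.pred)
        (t := (hfin (n - m) j (k - d)).toFinset), Set.ncard_eq_toFinset_card _ (hfin _ _ _),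
        mul_comm, ← smul_eq_mul, ← Finset.sum_const]
      · refine Finset.sum_congr rfl fun b hb => ?_
        rw [Set.Finite.mem_toFinset] at hb
        obtain rfl := hb.2.2.2.1
        rw [← ncard_weaves, ← Set.ncard_image_of_injective _ (List.cons_injective (a := 0)),
          ← setOf_mem_words_eq_image (k := k) hm hmn hd.1 hd.2.2 hb, ← Set.ncard_coe_finset]
        congr 1
        ext w
        simp
        grind
      · intro w hw
        simp only [Finset.coe_filter, Finset.mem_filter, Set.Finite.mem_toFinset,
          Set.mem_ofPred_eq] at hw
        obtain ⟨⟨hw, rfl⟩, rfl⟩ := hw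
        simpa using map_pred_nonzeros_mem_words hmn hw
    · intro w hw
      simp only [Finset.coe_filter, Set.Finite.mem_toFinset, Set.mem_ofPred_eq] at hw
      have hb := map_pred_nonzeros_mem_words hmn hw.1
      obtain ⟨v, hv⟩ := exists_eq_zero_cons_of_mem_words (by omega) hb
      have hlen := hb.1
      simp only [Finset.coe_Icc, Set.mem_Icc]
      exact ⟨by simp [hv], hlen ▸ List.count_le_length⟩
  · intro w hw
    simp only [Set.Finite.coe_toFinset] at hw
    have h := drops_pos_of_mem_words hmn hw
    have h' := drops_le_count_zero w
    have hcount := (List.tail_sublist w).count_le 0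
    have := hw.2.2.2.1
    simp only [Finset.coe_Icc, Set.mem_Icc]
    omega

lemma words_self {n : ℕ} (k : ℕ) :
    words n n k = if k = 0 then {List.replicate n 0} else ∅ := by
  have hdesc : descents (List.replicate n 0) = 0 := by
    induction n with
    | zero => rfl
    | succ n ih => rw [List.replicate_succ, descents_zero_cons, ih]
  have hrep : ∀ w ∈ words n n k, w = List.replicate n 0 := by
    rintro w ⟨hl, -, -, hc, -⟩
    exact List.eq_replicate_iff.2 ⟨hl, fun x hx =>
      (List.count_eq_length.1 (hc.trans hl.symm) x hx).symm⟩
  ext w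
  split_ifs with hk
  · rw [Set.mem_singleton_iff]
    refine ⟨hrep w, ?_⟩
    rintro rfl
    refine ⟨by simp, ?_, ?_, by simp, hk ▸ hdesc⟩
    · exact List.isChain_replicate_of_rel n (by simp)
    · intro u v j h
      have : j + 1 ∈ List.replicate n 0 := by simp [h]
      simp at this
  · simp only [Set.mem_empty_iff_false, iff_false]
    intro hw
    obtain rfl := hrep w hw
    exact hk (hw.2.2.2.2.symm.trans hdesc)

lemma aZD_self (n k : ℕ) : aZD n n k = if k = 0 then 1 else 0 := by
  rw [aZD_eq_ncard_words, words_self]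
  split_ifs <;> simp

lemma aZD_zero_of_lt {n m : ℕ} (h : m < n) : aZD n m 0 = 0 := by
  rw [aZD_eq_ncard_words, Set.ncard_eq_zero (finite_words n m 0), Set.eq_empty_iff_forall_notMem]
  intro w hw
  have := drops_pos_of_mem_words h hw
  omega

end CatalanWord

/-- Recurrence for the numbers `a(n,m,k)`, together with the boundary values
`a(n,n,k) = δ_{k,0}` for `n > k ≥ 0` and `a(n,m,0) = δ_{n,m}` for `n ≥ m ≥ 1`. -/
theorem aZD_recurrence :
    (∀ n m k : ℕ, 1 ≤ m → m < n → 1 ≤ k →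
      aZD n m k = ∑ d ∈ Finset.Icc 1 (min m k), ∑ j ∈ Finset.Icc 1 (n - m),
        Nat.choose (m - 1) d * Nat.choose j d * aZD (n - m) j (k - d)) ∧
    (∀ n k : ℕ, k < n → aZD n n k = if k = 0 then 1 else 0) ∧
    (∀ n m : ℕ, 1 ≤ m → m ≤ n → aZD n m 0 = if n = m then 1 else 0) := by
  refine ⟨fun n m k hm hmn _ => ?_, fun n k _ => CatalanWord.aZD_self n k, fun n m _ hmn => ?_⟩
  · simp only [CatalanWord.aZD_eq_ncard_words]
    exact CatalanWord.ncard_words_eq_sum hm hmn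
  · obtain rfl | hlt := hmn.eq_or_lt
    · simp [CatalanWord.aZD_self]
    · rw [CatalanWord.aZD_zero_of_lt hlt, if_neg hlt.ne']
end

section
/- For n ≥ 3 and 1 ≤ m ≤ n−2, b(n,m) = Σ_{i=2}^{n−m} (binomial(i+m−1, m) − 1)·a(n−i, m). Moreover b(n,0) = 1 for all n ≥ 1, and b(n,n−1) = 0 for all n ≥ 2. -/
/-- `aZ n m` is the number of Catalan words of length `n` with exactly `m` zeros. -/
noncomputable def aZ (n m : ℕ) : ℕ :=
  Set.ncard {a : Fin n → ℕ | IsCatalanWord a ∧ countEq a 0 = m}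

/-- `bO n m` is the number of Catalan words of length `n` with exactly `m` ones. -/
noncomputable def bO (n m : ℕ) : ℕ :=
  Set.ncard {a : Fin n → ℕ | IsCatalanWord a ∧ countEq a 1 = m}

/-- The list form of `IsCatalanWord`. -/
def IsCatalanList (l : List ℕ) : Prop :=
  l.IsChain (fun x y => x ≤ y + 1) ∧
    ∀ (k : ℕ) (p s : List ℕ), l = p ++ (k + 1) :: s → k + 1 ∉ p → k ∈ p ∧ k ∈ s

/-- Delete the zeros of a word and lower every other letter by one. -/
def lowerWord (l : List ℕ) : List ℕ := l.filterMap Nat.ppred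

@[simp] lemma lowerWord_nil : lowerWord [] = [] := rfl

@[simp] lemma lowerWord_zero_cons (l : List ℕ) : lowerWord (0 :: l) = lowerWord l := rfl

@[simp] lemma lowerWord_succ_cons (x : ℕ) (l : List ℕ) :
    lowerWord ((x + 1) :: l) = x :: lowerWord l := rfl

@[simp] lemma lowerWord_append (l₁ l₂ : List ℕ) :
    lowerWord (l₁ ++ l₂) = lowerWord l₁ ++ lowerWord l₂ := List.filterMap_append

@[simp] lemma lowerWord_replicate_zero (j : ℕ) : lowerWord (List.replicate j 0) = [] := by
  induction j with
  | zero => rfl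
  | succ j ih => simpa [List.replicate_succ] using ih

@[simp] lemma lowerWord_map_succ (l : List ℕ) : lowerWord (l.map (· + 1)) = l := by
  induction l with
  | nil => rfl
  | cons x l ih => simp [ih]

@[simp] lemma mem_lowerWord (k : ℕ) (l : List ℕ) : k ∈ lowerWord l ↔ k + 1 ∈ l := by
  simp [lowerWord, Nat.ppred_eq_some]

lemma count_lowerWord (k : ℕ) (l : List ℕ) : (lowerWord l).count k = l.count (k + 1) := by
  induction l with
  | nil => rfl
  | cons x l ih => cases x <;> simp [List.count_cons, ih]

lemma count_zero_add_length_lowerWord (l : List ℕ) :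
    l.count 0 + (lowerWord l).length = l.length := by
  induction l with
  | nil => rfl
  | cons x l ih => cases x <;> simp <;> omega

lemma eq_replicate_of_lowerWord_eq_nil (l : List ℕ) (h : lowerWord l = []) :
    l = List.replicate (l.count 0) 0 := by
  induction l with
  | nil => rfl
  | cons x l ih =>
    cases x with
    | zero => simpa [List.replicate_succ] using ih h
    | succ x => simp at h

lemma eq_map_succ_lowerWord (l : List ℕ) (h : 0 ∉ l) : l = (lowerWord l).map (· + 1) := by
  induction l with
  | nil => rfl
  | cons x l ih =>
    cases x with
    | zero => simp at h
    | succ x => simpa using ih (by simpa using h)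

lemma isChain_lowerWord (l : List ℕ) (p : ℕ) (h : (p :: l).IsChain (fun x y => x ≤ y + 1)) :
    ((p - 1) :: lowerWord l).IsChain (fun x y => x ≤ y + 1) := by
  induction l generalizing p with
  | nil => simp
  | cons x l ih =>
    rw [List.isChain_cons_cons] at h
    cases x with
    | zero =>
      have hp : p - 1 = 0 - 1 := by omega
      rw [hp]
      exact ih 0 h.2
    | succ x =>
      rw [lowerWord_succ_cons, List.isChain_cons_cons]
      exact ⟨by omega, ih _ h.2⟩

/-- Words lowering to `w`, with `j` zeros, satisfying the descent condition after a letter `p`. -/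
def raisings (p : ℕ) (w : List ℕ) (j : ℕ) : Set (List ℕ) :=
  {u | (p :: u).IsChain (fun x y => x ≤ y + 1) ∧ lowerWord u = w ∧ u.count 0 = j}

lemma raisings_nil_of_le {p : ℕ} (hp : p ≤ 1) (j : ℕ) :
    raisings p [] j = {List.replicate j 0} := by
  ext u
  simp only [raisings, Set.mem_ofPred_eq, Set.mem_singleton_iff]
  constructor
  · rintro ⟨-, h, rfl⟩
    exact eq_replicate_of_lowerWord_eq_nil u h
  · rintro rfl
    refine ⟨?_, by simp, by simp⟩
    cases j with
    | zero => simp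
    | succ j =>
      rw [List.replicate_succ, List.isChain_cons_cons]
      refine ⟨by omega, ?_⟩
      rw [← List.replicate_succ]
      exact List.isChain_replicate_of_rel _ (by omega)

lemma raisings_nil_succ_of_lt {p : ℕ} (hp : 1 < p) (j : ℕ) : raisings p [] (j + 1) = ∅ := by
  ext u
  simp only [raisings, Set.mem_ofPred_eq, Set.mem_empty_iff_false, iff_false]
  rintro ⟨h, h0, hj⟩
  have := eq_replicate_of_lowerWord_eq_nil u h0
  rw [hj, List.replicate_succ] at this
  rw [this, List.isChain_cons_cons] at h
  omega

lemma raisings_zero (p : ℕ) (w : List ℕ) (h : ((p - 1) :: w).IsChain (fun x y => x ≤ y + 1)) :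
    raisings p w 0 = {w.map (· + 1)} := by
  ext u
  simp only [raisings, Set.mem_ofPred_eq, Set.mem_singleton_iff, List.count_eq_zero]
  constructor
  · rintro ⟨-, rfl, h0⟩
    exact eq_map_succ_lowerWord u h0
  · rintro rfl
    refine ⟨?_, by simp, by simp⟩
    induction w generalizing p with
    | nil => simp
    | cons x w ih =>
      rw [List.isChain_cons_cons] at h
      rw [List.map_cons, List.isChain_cons_cons]
      exact ⟨by omega, ih _ h.2⟩

lemma raisings_cons_succ_of_le {p x : ℕ} (hp : p ≤ 1) (w : List ℕ) (j : ℕ) :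
    raisings p (x :: w) (j + 1) =
      List.cons 0 '' raisings 0 (x :: w) j ∪ List.cons (x + 1) '' raisings (x + 1) w (j + 1) := by
  ext u
  rcases u with _ | ⟨_ | y, u⟩
  · simp [raisings]
  · simp [raisings, hp]
  · simp only [raisings, Set.mem_ofPred_eq, Set.mem_union, Set.mem_image, List.isChain_cons_cons,
      lowerWord_succ_cons, List.cons.injEq, List.count_cons]
    grind

lemma raisings_cons_of_lt {p x : ℕ} (hp : 1 < p) (hx : p ≤ x + 2) (w : List ℕ) (j : ℕ) :
    raisings p (x :: w) j = List.cons (x + 1) '' raisings (x + 1) w j := by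
  ext u
  rcases u with _ | ⟨_ | y, u⟩
  · simp [raisings]
  · simp [raisings, hp]
  · simp only [raisings, Set.mem_ofPred_eq, Set.mem_image, List.isChain_cons_cons,
      lowerWord_succ_cons, List.cons.injEq, List.count_cons]
    grind

lemma encard_raisings (w : List ℕ) (j p : ℕ)
    (h : ((p - 1) :: w).IsChain (fun x y => x ≤ y + 1)) :
    (raisings p w j).encard =
      ((if p ≤ 1 then w.count 0 + 1 else w.count 0).multichoose j : ℕ) := by
  induction w generalizing j p with
  | nil =>
    split_ifs with hp
    · simp [raisings_nil_of_le hp]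
    · cases j with
      | zero => simp [raisings_zero _ _ h]
      | succ j => simp [raisings_nil_succ_of_lt (not_le.1 hp), Nat.multichoose_zero_succ]
  | cons x w ih =>
    have hx := List.isChain_cons_cons.1 h
    have key : ∀ j, (raisings (x + 1) w j).encard = (((x :: w).count 0).multichoose j : ℕ) := by
      intro j
      rw [ih j (x + 1) hx.2]
      cases x <;> simp
    split_ifs with hp
    · have hchain : (0 :: x :: w).IsChain (fun x y => x ≤ y + 1) := by
        rwa [show p - 1 = 0 by omega] at h
      clear h hx
      induction j generalizing p with
      | zero => simp [raisings_zero p (x :: w) (by rwa [show p - 1 = 0 by omega])]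
      | succ j ihj =>
        rw [raisings_cons_succ_of_le hp, Set.encard_union_eq,
          (List.cons_injective).encard_image, (List.cons_injective).encard_image, key,
          ihj 0 (by omega), Nat.multichoose_succ_succ]
        · push_cast
          ring
        · rw [Set.disjoint_left]
          rintro _ ⟨u, -, rfl⟩ ⟨v, -, hv⟩
          simp at hv
    · rw [raisings_cons_of_lt (not_le.1 hp) (by omega), List.cons_injective.encard_image, key]

lemma IsCatalanList.mem_of_le {l : List ℕ} (h : IsCatalanList l) {k : ℕ} (hk : k ∈ l) :
    ∀ i ≤ k, i ∈ l := by
  induction k with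
  | zero => grind
  | succ k ih =>
    intro i hi
    obtain ⟨p, s, e, hp⟩ := List.eq_append_cons_of_mem hk
    have := (h.2 k p s e hp).1
    rcases Nat.le_succ_iff.1 hi with hi | rfl
    · exact ih (by simp [e, this]) i hi
    · exact hk

lemma IsCatalanList.lt_length {l : List ℕ} (h : IsCatalanList l) {k : ℕ} (hk : k ∈ l) :
    k < l.length := by
  have hs : Finset.range (k + 1) ⊆ l.toFinset := by
    intro i hi
    simpa using h.mem_of_le hk i (by simpa [Nat.lt_succ_iff] using hi)
  have := (Finset.card_le_card hs).trans l.toFinset_card_le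
  simpa using this

lemma finite_isCatalanList (n : ℕ) : {l : List ℕ | l.length = n ∧ IsCatalanList l}.Finite := by
  refine ((List.finite_length_eq (Fin n) n).image (List.map Fin.val)).subset ?_
  rintro l ⟨rfl, h⟩
  exact ⟨l.attach.map fun x => ⟨x.1, h.lt_length x.2⟩, by simp, by simp [Function.comp_def]⟩

lemma IsCatalanList.eq_zero_cons {l : List ℕ} (h : IsCatalanList l) (hl : l ≠ []) :
    ∃ t, l = 0 :: t := by
  rcases l with _ | ⟨_ | x, t⟩
  · simp at hl
  · exact ⟨t, rfl⟩
  · have := h.2 x [] t rfl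
    simp at this

lemma IsCatalanList.two_le_count_zero {l : List ℕ} (h : IsCatalanList l) (h1 : 1 ∈ l) :
    2 ≤ l.count 0 := by
  obtain ⟨p, s, rfl, hp⟩ := List.eq_append_cons_of_mem h1
  obtain ⟨h₁, h₂⟩ := h.2 0 p s rfl hp
  have := List.count_pos_iff.2 h₁
  have := List.count_pos_iff.2 h₂
  rw [List.count_append, List.count_cons]
  omega

lemma IsCatalanList.eq_replicate {l : List ℕ} (h : IsCatalanList l) (h1 : 1 ∉ l) :
    l = List.replicate l.length 0 := by
  rw [List.eq_replicate_iff]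
  refine ⟨rfl, fun b hb => ?_⟩
  by_contra hb0
  exact h1 (h.mem_of_le hb 1 (by omega))

lemma isCatalanList_replicate_zero (n : ℕ) : IsCatalanList (List.replicate n 0) := by
  refine ⟨List.isChain_replicate_of_rel _ (by omega), fun k p s h _ => ?_⟩
  have : k + 1 ∈ List.replicate n 0 := by simp [h]
  simp at this

lemma lowerWord_eq_append_cons {u p s : List ℕ} {k : ℕ} (h : lowerWord u = p ++ k :: s) :
    ∃ p' s', u = p' ++ (k + 1) :: s' ∧ lowerWord p' = p ∧ lowerWord s' = s := by
  obtain ⟨l₁, l₂, rfl, rfl, h₂⟩ := List.filterMap_eq_append_iff.1 h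
  obtain ⟨l₃, a, l₄, rfl, h₃, h₄, rfl⟩ := List.filterMap_eq_cons_iff.1 h₂
  refine ⟨l₁ ++ l₃, l₄, ?_, ?_, rfl⟩
  · simp [← Nat.ppred_eq_some.1 h₄]
  · rw [lowerWord_append, show lowerWord l₃ = [] from List.filterMap_eq_nil_iff.2 h₃]
    simp [lowerWord]

lemma IsCatalanList.lowerWord {u : List ℕ} (h : IsCatalanList u) :
    IsCatalanList (lowerWord u) := by
  refine ⟨?_, fun k p s e hp => ?_⟩
  · rcases eq_or_ne u [] with rfl | hu
    · simp
    obtain ⟨t, rfl⟩ := h.eq_zero_cons hu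
    exact (isChain_lowerWord t 0 h.1).tail
  · obtain ⟨p', s', rfl, rfl, rfl⟩ := lowerWord_eq_append_cons e
    simpa using h.2 (k + 1) p' s' rfl (by simpa using hp)

/-- The Catalan words with `j` zeros lowering to the nonempty Catalan word `w` start with a zero
and continue by a raising of `w`; only the word with all its zeros in front is excluded. -/
lemma isCatalanList_raising_iff {w : List ℕ} (hw : IsCatalanList w) (hw0 : w ≠ []) (j : ℕ) :
    {u | IsCatalanList u ∧ lowerWord u = w ∧ u.count 0 = j + 1} =
      (List.cons 0 '' raisings 0 w j) \ {List.replicate (j + 1) 0 ++ w.map (· + 1)} := by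
  obtain ⟨w', rfl⟩ := hw.eq_zero_cons hw0
  ext u
  simp only [Set.mem_ofPred_eq, Set.mem_sdiff, Set.mem_image, Set.mem_singleton_iff]
  constructor
  · rintro ⟨h, hl, hc⟩
    obtain ⟨t, rfl⟩ := h.eq_zero_cons (by rintro rfl; simp at hc)
    refine ⟨⟨t, ⟨h.1, by simpa using hl, by simpa using hc⟩, rfl⟩, fun e => ?_⟩
    have := (h.2 0 (List.replicate (j + 1) 0) (w'.map (· + 1)) (by simpa using e) (by simp)).2
    simp at this
  · rintro ⟨⟨t, ⟨h₁, h₂, h₃⟩, rfl⟩, hne⟩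
    refine ⟨⟨h₁, fun k p s e hp => ?_⟩, by simpa using h₂, by simpa using h₃⟩
    have e' : 0 :: w' = lowerWord p ++ k :: lowerWord s := by
      rw [← h₂, ← lowerWord_zero_cons, e]
      simp
    cases k with
    | succ k =>
      simpa using hw.2 k _ _ e' (by simpa using hp)
    | zero =>
      have hp0 : lowerWord p = [] := by
        rcases hq : lowerWord p with _ | ⟨x, q⟩
        · rfl
        · rw [hq] at e'
          have : 0 ∈ lowerWord p := by
            rw [hq]
            simp_all
          exact absurd ((mem_lowerWord 0 p).1 this) hp
      constructor
      · rcases p with _ | ⟨x, p⟩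
        · simp at e
        · simp_all
      · by_contra hs
        apply hne
        have hs' := eq_map_succ_lowerWord s hs
        have hp' := eq_replicate_of_lowerWord_eq_nil p hp0
        have hcount : p.count 0 = j + 1 := by
          have := congrArg (List.count 0) e
          simp [h₃, List.count_eq_zero.2 hs] at this
          exact this.symm
        rw [hp0] at e'
        simp only [List.nil_append, List.cons.injEq, true_and] at e'
        rw [e, e', List.map_cons, ← hs', ← hcount, ← hp']

lemma ncard_isCatalanList_lowerWord_eq {w : List ℕ} (hw : IsCatalanList w) (hw0 : w ≠ []) (j : ℕ) :
    {u | IsCatalanList u ∧ lowerWord u = w ∧ u.count 0 = j + 1}.ncard =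
      (j + w.count 0).choose (w.count 0) - 1 := by
  have hchain : ((0 - 1) :: w).IsChain (fun x y => x ≤ y + 1) := by
    obtain ⟨w', rfl⟩ := hw.eq_zero_cons hw0
    rw [List.isChain_cons_cons]
    exact ⟨by omega, hw.1⟩
  rw [isCatalanList_raising_iff hw hw0, Set.ncard, Set.encard_sdiff_singleton_of_mem,
    List.cons_injective.encard_image, encard_raisings w j 0 hchain, if_pos zero_le_one,
    Nat.multichoose_eq]
  · have : w.count 0 + 1 + j - 1 = j + w.count 0 := by omega
    rw [this, Nat.choose_symm_add]
    norm_cast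
  · refine ⟨List.replicate j 0 ++ w.map (· + 1), ⟨?_, by simp, ?_⟩, by simp [List.replicate_succ]⟩
    · rw [← List.cons_append, ← List.replicate_succ, List.isChain_append]
      refine ⟨List.isChain_replicate_of_rel _ (by omega), ?_, ?_⟩
      · rw [List.isChain_map]
        exact hw.1.imp (by intros; omega)
      · intro x hx y _
        have := List.mem_of_getLast? hx
        simp at this
        omega
    · rw [List.count_append, (List.count_eq_zero.2 (by simp) : (w.map (· + 1)).count 0 = 0)]
      simp

lemma isCatalanWord_iff {n : ℕ} (a : Fin n → ℕ) :
    IsCatalanWord a ↔ IsCatalanList (List.ofFn a) := by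
  unfold IsCatalanWord IsCatalanList
  refine and_congr ?_ ⟨fun h k p s e hp => ?_, fun h i hi hmin => ?_⟩
  · rw [List.isChain_iff_getElem]
    simp
  · have hn : n = p.length + 1 + s.length := by
      have := congrArg List.length e
      simp at this
      omega
    have ha : ∀ j : Fin n, (p ++ (k + 1) :: s)[(j : ℕ)]? = some (a j) := by
      intro j
      rw [← e]
      simp
    have hi := ha ⟨p.length, by omega⟩
    simp at hi
    obtain ⟨⟨i₁, h₁, e₁⟩, ⟨i₂, h₂, e₂⟩⟩ := h ⟨p.length, by omega⟩ (by omega) (by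
      intro j hj
      by_contra hlt
      have hlt' : (j : ℕ) < p.length := not_le.1 fun hle => hlt (Fin.le_def.2 hle)
      have := ha j
      rw [List.getElem?_append_left hlt'] at this
      apply hp
      rw [hi, ← hj]
      exact List.mem_of_getElem? this)
    constructor
    · have := ha i₁
      rw [List.getElem?_append_left (Fin.lt_def.1 h₁)] at this
      have hk : k = a i₁ := by omega
      rw [hk]
      exact List.mem_of_getElem? this
    · have := ha i₂
      have h₂' : p.length < (i₂ : ℕ) := Fin.lt_def.1 h₂
      obtain ⟨d, hd⟩ := Nat.exists_eq_add_of_lt h₂'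
      rw [List.getElem?_append_right (by omega), hd,
        show p.length + d + 1 - p.length = d + 1 by omega, List.getElem?_cons_succ] at this
      have hk : k = a i₂ := by omega
      rw [hk]
      exact List.mem_of_getElem? this
  · obtain ⟨k, hk⟩ := Nat.exists_eq_add_of_lt hi
    rw [zero_add] at hk
    obtain ⟨h₁, h₂⟩ := h k ((List.ofFn a).take i) ((List.ofFn a).drop (i + 1)) (by
        have hlen : (i : ℕ) < (List.ofFn a).length := by simp
        have hget : (List.ofFn a)[(i : ℕ)] = k + 1 := by simp [hk]
        rw [← hget, List.getElem_cons_drop, List.take_append_drop]) (by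
        rw [← hk]
        intro hmem
        obtain ⟨j, hj, e⟩ := List.mem_take_iff_getElem.1 hmem
        simp at hj e
        have := hmin ⟨j, by omega⟩ e
        rw [Fin.le_def] at this
        simp at this
        omega)
    constructor
    · obtain ⟨j, hj, e⟩ := List.mem_take_iff_getElem.1 h₁
      simp at hj e
      exact ⟨⟨j, by omega⟩, by simp [Fin.lt_def]; omega, by omega⟩
    · obtain ⟨j, hj, e⟩ := List.mem_drop_iff_getElem.1 h₂
      simp at hj e
      exact ⟨⟨i + 1 + j, by omega⟩, by simp [Fin.lt_def]; omega, by omega⟩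

lemma countEq_eq_count {n : ℕ} (a : Fin n → ℕ) (c : ℕ) :
    countEq a c = (List.ofFn a).count c := by
  unfold countEq
  rw [Set.ncard_eq_toFinset_card']
  induction n with
  | zero => simp
  | succ n ih =>
    rw [List.ofFn_succ, List.count_cons, ← ih (fun i => a i.succ)]
    simp only [Set.toFinset_ofPred]
    rw [Fin.card_filter_univ_succ]
    by_cases h : a 0 = c <;> simp [h]

lemma ncard_isCatalanWord (n c m : ℕ) :
    {a : Fin n → ℕ | IsCatalanWord a ∧ countEq a c = m}.ncard =
      {l : List ℕ | (l.length = n ∧ IsCatalanList l) ∧ l.count c = m}.ncard := by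
  rw [← Set.ncard_image_of_injective _ List.ofFn_injective]
  congr 1
  ext l
  simp only [Set.mem_image, Set.mem_ofPred_eq, isCatalanWord_iff, countEq_eq_count]
  constructor
  · rintro ⟨a, ⟨h₁, h₂⟩, rfl⟩
    exact ⟨⟨by simp, h₁⟩, h₂⟩
  · rintro ⟨⟨rfl, h₁⟩, h₂⟩
    exact ⟨fun i => l[i], by simp [h₁, h₂], by simp⟩

open Finset in
lemma bO_eq_sum (n m : ℕ) (hm : 1 ≤ m) :
    bO n m = ∑ i ∈ Finset.Icc 2 (n - m), (Nat.choose (i + m - 1) m - 1) * aZ (n - i) m := by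
  classical
  have hfin : ∀ n c m, {l : List ℕ | (l.length = n ∧ IsCatalanList l) ∧ l.count c = m}.Finite :=
    fun n c m => (finite_isCatalanList n).subset fun l hl => hl.1
  unfold bO aZ
  simp only [ncard_isCatalanWord]
  rw [Set.ncard_eq_toFinset_card _ (hfin n 1 m),
    card_eq_sum_card_fiberwise (f := List.count 0) (t := Icc 2 (n - m))]
  swap
  · intro u hu
    simp only [Set.Finite.coe_toFinset, Set.mem_ofPred_eq] at hu
    obtain ⟨⟨rfl, h⟩, hc⟩ := hu
    have := h.two_le_count_zero (List.count_pos_iff.1 (by omega))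
    have := count_zero_add_length_lowerWord u
    have h1 := count_lowerWord 0 u
    have := List.count_le_length (a := 0) (l := lowerWord u)
    simp at h1 ⊢
    omega
  refine sum_congr rfl fun i hi => ?_
  rw [mem_Icc] at hi
  rw [Set.ncard_eq_toFinset_card _ (hfin (n - i) 0 m),
    card_eq_sum_card_fiberwise (f := lowerWord) (t := (hfin (n - i) 0 m).toFinset)]
  swap
  · intro u hu
    simp only [coe_filter, Set.Finite.mem_toFinset, Set.mem_ofPred_eq, Set.Finite.coe_toFinset]
      at hu ⊢
    obtain ⟨⟨⟨rfl, h⟩, hc⟩, hc0⟩ := hu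
    have := count_zero_add_length_lowerWord u
    exact ⟨⟨by omega, h.lowerWord⟩, by rw [count_lowerWord, hc]⟩
  rw [sum_const_nat (m := (i + m - 1).choose m - 1), mul_comm]
  intro w hw
  simp only [Set.Finite.mem_toFinset, Set.mem_ofPred_eq] at hw
  obtain ⟨⟨hlen, hw⟩, hc⟩ := hw
  have hw0 : w ≠ [] := by
    rintro rfl
    simp at hc
    omega
  have key := ncard_isCatalanList_lowerWord_eq hw hw0 (i - 1)
  rw [hc, show i - 1 + 1 = i by omega, show i - 1 + m = i + m - 1 by omega] at key
  rw [← key, ← Set.ncard_coe_finset]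
  congr 1
  ext u
  simp only [coe_filter, mem_filter, Set.Finite.mem_toFinset, Set.mem_ofPred_eq]
  constructor
  · rintro ⟨⟨⟨⟨_, h⟩, _⟩, h0⟩, hl⟩
    exact ⟨h, hl, h0⟩
  · rintro ⟨h, rfl, h0⟩
    have := count_zero_add_length_lowerWord u
    rw [count_lowerWord] at hc
    exact ⟨⟨⟨⟨by omega, h⟩, hc⟩, h0⟩, rfl⟩

lemma bO_zero_right (n : ℕ) : bO n 0 = 1 := by
  unfold bO
  rw [ncard_isCatalanWord, Set.ncard_eq_one]
  refine ⟨List.replicate n 0, ?_⟩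
  ext l
  simp only [Set.mem_ofPred_eq, Set.mem_singleton_iff, List.count_eq_zero]
  constructor
  · rintro ⟨⟨rfl, h⟩, h1⟩
    exact h.eq_replicate h1
  · rintro rfl
    exact ⟨⟨by simp, isCatalanList_replicate_zero n⟩, by simp⟩

lemma bO_sub_one_right (n : ℕ) (hn : 2 ≤ n) : bO n (n - 1) = 0 := by
  rw [bO_eq_sum n (n - 1) (by omega), Finset.Icc_eq_empty (by omega), Finset.sum_empty]

/-- Recurrence expressing `b(n,m)` in terms of the numbers `a(n,m)`, together with the
boundary values `b(n,0) = 1` for `n ≥ 1` and `b(n,n-1) = 0` for `n ≥ 2`. -/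
theorem bO_recurrence :
    (∀ n m : ℕ, 3 ≤ n → 1 ≤ m → m ≤ n - 2 →
      bO n m = ∑ i ∈ Finset.Icc 2 (n - m), (Nat.choose (i + m - 1) m - 1) * aZ (n - i) m) ∧
    (∀ n : ℕ, 1 ≤ n → bO n 0 = 1) ∧
    (∀ n : ℕ, 2 ≤ n → bO n (n - 1) = 0) :=
  ⟨fun n m _ hm _ => bO_eq_sum n m hm, fun n _ => bO_zero_right n, bO_sub_one_right⟩
end

section
/- Let 0 < x < 1/4 and 0 ≤ v ≤ 1 be real, let t = 1/(2√x), and define L_{−1}(x,v) = v and L_j(x,v) = 1/(1 − x·L_{j−1}(x,v)) for j ≥ 0. Then for every integer j ≥ −1, L_j(x,v) = ( ((1−xv)/√x)·U_{j−1}(t) − U_{j−2}(t) ) / ( √x·( ((1−xv)/√x)·U_j(t) − U_{j−1}(t) ) ). -/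
/-- Evaluation at `t` of the `n`-th Chebyshev polynomial of the second kind, with the
index extended to all integers by the recurrence `U n = 2x·U (n-1) - U (n-2)`
(so `U (-1) = 0`, `U (-2) = -1`). -/
noncomputable def chebU (n : ℤ) (t : ℝ) : ℝ := (Polynomial.Chebyshev.U ℝ n).eval t

/-- `Lm x v k` represents `L_{k-1}(x,v)`, i.e. `Lm x v 0 = L₋₁(x,v) = v` and
`Lm x v (k+1) = L_k(x,v) = 1/(1 - x · L_{k-1}(x,v))`. -/
noncomputable def Lm (x v : ℝ) : ℕ → ℝ
  | 0 => v
  | k + 1 => 1 / (1 - x * Lm x v k)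

theorem chebU_add_two (n : ℤ) (t : ℝ) :
    chebU (n + 2) t = 2 * t * chebU (n + 1) t - chebU n t := by
  simp [chebU, Polynomial.Chebyshev.U_add_two]

/-- If `d` solves the linear recurrence `d (n + 2) = d (n + 1) / s - d n` with `d 0 = s * v` and
`d 1 = 1`, then its ratios of consecutive terms solve the recurrence of `Lm (s ^ 2) v`. The bounds
say that `d (k + 1)` is positive and that `Lm (s ^ 2) v k ≤ 2`. -/
theorem Lm_eq_div_of_linear_recurrence {s v : ℝ} (hs0 : 0 < s) (hs : s ^ 2 < 1 / 4) (hv : v ≤ 1)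
    {d : ℕ → ℝ} (h0 : d 0 = s * v) (h1 : d 1 = 1)
    (hd : ∀ n, d (n + 2) = d (n + 1) / s - d n) (k : ℕ) :
    0 < d (k + 1) ∧ d k ≤ 2 * s * d (k + 1) ∧ Lm (s ^ 2) v k = d k / (s * d (k + 1)) := by
  induction k with
  | zero =>
    refine ⟨by simp [h1], by rw [h0, h1]; nlinarith, ?_⟩
    rw [Lm, h0, h1]
    field_simp
  | succ k ih =>
    obtain ⟨hpos, hle, hL⟩ := ih
    have hstep : s * d (k + 2) = d (k + 1) - s * d k := by
      rw [hd]
      field_simp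
    have hhalf : d (k + 1) ≤ 2 * s * d (k + 2) := by
      nlinarith [mul_le_mul_of_nonneg_left hle hs0.le, mul_lt_mul_of_pos_right hs hpos]
    have hpos' : 0 < d (k + 2) := by
      by_contra! h
      nlinarith
    refine ⟨hpos', hhalf, ?_⟩
    have hden : 1 - s ^ 2 * Lm (s ^ 2) v k = s * d (k + 2) / d (k + 1) := by
      rw [hL, hstep]
      field_simp
    rw [Lm, hden, one_div_div]

/-- Closed form for `L_j(x,v)` (for `j ≥ -1`, represented as `j = k - 1` with `k : ℕ`)
in terms of Chebyshev polynomials evaluated at `t = 1/(2√x)`: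
`L_j = (((1-xv)/√x)·U_{j-1}(t) - U_{j-2}(t)) / (√x·(((1-xv)/√x)·U_j(t) - U_{j-1}(t)))`. -/
theorem Lm_chebyshev_closed_form (x v : ℝ) (hx0 : 0 < x) (hx : x < 1/4)
    (hv0 : 0 ≤ v) (hv1 : v ≤ 1) (k : ℕ) :
    Lm x v k =
      ((1 - x * v) / Real.sqrt x * chebU ((k : ℤ) - 2) (1 / (2 * Real.sqrt x)) -
          chebU ((k : ℤ) - 3) (1 / (2 * Real.sqrt x))) /
        (Real.sqrt x * ((1 - x * v) / Real.sqrt x * chebU ((k : ℤ) - 1) (1 / (2 * Real.sqrt x)) -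
          chebU ((k : ℤ) - 2) (1 / (2 * Real.sqrt x)))) := by
  have hs0 : 0 < √x := Real.sqrt_pos.2 hx0
  have hsq : √x ^ 2 = x := Real.sq_sqrt hx0.le
  let d : ℕ → ℝ := fun n => (1 - x * v) / √x * chebU ((n : ℤ) - 2) (1 / (2 * √x)) -
    chebU ((n : ℤ) - 3) (1 / (2 * √x))
  have h0 : d 0 = √x * v := by
    have h3 := chebU_add_two (-3) (1 / (2 * √x))
    norm_num [chebU] at h3
    simp only [d, chebU]
    norm_num
    rw [show Polynomial.eval ((√x)⁻¹ * (1 / 2)) (Polynomial.Chebyshev.U ℝ (-3)) = -(√x)⁻¹ by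
      linarith]
    field_simp
    rw [hsq]
    ring
  have h1 : d 1 = 1 := by simp [d, chebU]
  have hd : ∀ n, d (n + 2) = d (n + 1) / √x - d n := by
    intro n
    have ha := chebU_add_two ((n : ℤ) - 2) (1 / (2 * √x))
    have hb := chebU_add_two ((n : ℤ) - 3) (1 / (2 * √x))
    simp only [d]
    push_cast
    rw [show (n : ℤ) + 2 - 2 = n - 2 + 2 by ring, show (n : ℤ) + 2 - 3 = n - 3 + 2 by ring,
      show (n : ℤ) + 1 - 2 = n - 2 + 1 by ring, show (n : ℤ) + 1 - 3 = n - 3 + 1 by ring, ha, hb]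
    field_simp
    ring
  have h := (Lm_eq_div_of_linear_recurrence hs0 (hsq.trans_lt hx) hv1 h0 h1 hd k).2.2
  rw [hsq] at h
  rw [h]
  simp only [d]
  push_cast
  rw [show (k : ℤ) + 1 - 2 = k - 1 by ring, show (k : ℤ) + 1 - 3 = k - 2 by ring]
end
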